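/- Let 0 < β < 1 and let f ∈ C^1([0,∞)) be such that f and f′ are of exponential order. Then for every t > 0, the Caputo derivative of the Wright-type transform of f satisfies D_c^β f_β(t) = ∫_0^∞ f′(x) g_β(x;t) dx. -/

import Mathlib

open MeasureTheory Real Set Filter

/-- The Wright-type density `g_β(x;t) = t^{-β} ∑_{k} (−x/t^β)^k / (k! Γ(1 − β(k+1)))`. -/
noncomputable def wrightG (β x t : ℝ) : ℝ :=
  t ^ (-β) * ∑' k : ℕ, (-x / t ^ β) ^ k / ((Nat.factorial k : ℝ) * Real.Gamma (1 - β * (k + 1)))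

/-- The two-parameter Mittag-Leffler function `E_{β,α}(z) = ∑_k z^k / Γ(βk + α)`. -/
noncomputable def mittagLeffler (β α z : ℝ) : ℝ :=
  ∑' k : ℕ, z ^ k / Real.Gamma (β * k + α)

/-- The Caputo fractional derivative of order `β ∈ (0,1)`:
`D_c^β h(t) = (1/Γ(1−β)) ∫_0^t (t−τ)^{−β} h′(τ) dτ`. -/
noncomputable def caputo (β : ℝ) (h : ℝ → ℝ) (t : ℝ) : ℝ :=
  (1 / Real.Gamma (1 - β)) * ∫ τ in (0:ℝ)..t, (t - τ) ^ (-β) * deriv h τ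

/-- A function is of exponential order on `[0,∞)` if `|h(x)| ≤ C e^{a x}` there. -/
def ExpOrder (h : ℝ → ℝ) : Prop :=
  ∃ C a : ℝ, 0 < C ∧ 0 < a ∧ ∀ x : ℝ, 0 ≤ x → |h x| ≤ C * Real.exp (a * x)

open Topology

lemma integrableOn_rpow_mul_exp_neg_mul_Ioi {s b : ℝ} (hs : 0 < s) (hb : 0 < b) :
    IntegrableOn (fun t : ℝ => t ^ (s - 1) * Real.exp (-(b * t))) (Ioi 0) := by
  by_contra h
  have h1 := Real.integral_rpow_mul_exp_neg_mul_Ioi hs hb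
  rw [integral_undef h] at h1
  have : 0 < (1 / b) ^ s * Real.Gamma s := by
    have := Real.Gamma_pos_of_pos hs
    positivity
  linarith

lemma integrableOn_rpow_mul_exp_neg_mul_rpow_Ioi {p q b : ℝ} (hp : 0 < p) (hq : -1 < q)
    (hb : 0 < b) :
    IntegrableOn (fun t : ℝ => t ^ q * Real.exp (-b * t ^ p)) (Ioi 0) := by
  by_contra h
  have h1 := integral_rpow_mul_exp_neg_mul_rpow hp hq hb
  rw [integral_undef h] at h1
  have : 0 < b ^ (-(q + 1) / p) * (1 / p) * Real.Gamma ((q + 1) / p) := by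
    have := Real.Gamma_pos_of_pos (show 0 < (q + 1) / p by apply div_pos <;> linarith)
    positivity
  linarith

/-- The Laplace transform of `t ^ (s - 1)` on the open right half plane. -/
lemma integral_rpow_mul_cexp_neg_mul_Ioi {s : ℝ} (hs : 0 < s) {r : ℂ} (hr : 0 < r.re) :
    ∫ t in Ioi (0 : ℝ), ((t ^ (s - 1) : ℝ) : ℂ) * Complex.exp (-(r * t)) =
      r ^ (-s : ℂ) * (Real.Gamma s : ℂ) := by
  set G : ℂ → ℂ := fun r => ∫ t in Ioi (0 : ℝ), ((t ^ (s - 1) : ℝ) : ℂ) * Complex.exp (-(r * t))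
  have hopen : IsOpen {r : ℂ | 0 < r.re} := isOpen_lt continuous_const Complex.continuous_re
  have hmeas : Measurable fun t : ℝ => ((t ^ (s - 1) : ℝ) : ℂ) := by fun_prop
  have hint : ∀ r : ℂ, 0 < r.re → IntegrableOn
      (fun t : ℝ => ((t ^ (s - 1) : ℝ) : ℂ) * Complex.exp (-(r * t))) (Ioi 0) := by
    intro r hr
    refine (integrableOn_rpow_mul_exp_neg_mul_Ioi hs hr).mono'
      (by fun_prop) ?_
    refine (ae_restrict_iff' measurableSet_Ioi).2 (ae_of_all _ fun t ht => ?_)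
    have ht : 0 < t := ht
    rw [norm_mul, Complex.norm_exp, Complex.norm_real, Real.norm_of_nonneg (by positivity)]
    simp
  have hG : DifferentiableOn ℂ G {r : ℂ | 0 < r.re} := by
    intro r hr
    have hr : 0 < r.re := hr
    refine DifferentiableAt.differentiableWithinAt ?_
    have hs' : {z : ℂ | r.re / 2 < z.re} ∈ 𝓝 r :=
      (isOpen_lt continuous_const Complex.continuous_re).mem_nhds (by simp; linarith)
    refine (hasDerivAt_integral_of_dominated_loc_of_deriv_le
      (μ := volume.restrict (Ioi (0 : ℝ)))
      (F := fun (z : ℂ) (t : ℝ) => ((t ^ (s - 1) : ℝ) : ℂ) * Complex.exp (-(z * t)))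
      (F' := fun (z : ℂ) (t : ℝ) => ((t ^ (s - 1) : ℝ) : ℂ) * (Complex.exp (-(z * t)) * (-t)))
      (bound := fun t : ℝ => t ^ ((s + 1) - 1) * Real.exp (-(r.re / 2 * t))) hs'
      (Eventually.of_forall fun z => by fun_prop) (hint r hr) (by fun_prop) ?_
      (integrableOn_rpow_mul_exp_neg_mul_Ioi (by linarith) (by linarith))
      ?_).2.differentiableAt
    · refine (ae_restrict_iff' measurableSet_Ioi).2 (ae_of_all _ fun t ht z hz => ?_)
      have ht : 0 < t := ht
      have hz : r.re / 2 < z.re := hz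
      rw [norm_mul, norm_mul, Complex.norm_exp, Complex.norm_real,
        Real.norm_of_nonneg (by positivity), norm_neg, Complex.norm_real,
        Real.norm_of_nonneg ht.le, show s + 1 - 1 = (s - 1) + 1 by ring, Real.rpow_add_one ht.ne',
        mul_assoc, mul_comm t]
      gcongr
      simp
      gcongr
    · refine ae_of_all _ fun t z _ => ?_
      have := ((hasDerivAt_id z).mul_const (t : ℂ)).neg.cexp.const_mul ((t ^ (s - 1) : ℝ) : ℂ)
      simpa using this
  have hH : DifferentiableOn ℂ (fun r : ℂ => r ^ (-s : ℂ) * (Real.Gamma s : ℂ))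
      {r : ℂ | 0 < r.re} := by
    intro r hr
    refine DifferentiableAt.differentiableWithinAt ?_
    exact (differentiableAt_id.cpow_const (Or.inl hr)).mul_const _
  have hreal : ∀ b : ℝ, 0 < b → G b = (b : ℂ) ^ (-s : ℂ) * (Real.Gamma s : ℂ) := by
    intro b hb
    have h1 := Complex.integral_cpow_mul_exp_neg_mul_Ioi (a := s) (by simpa using hs) hb
    rw [Complex.Gamma_ofReal, one_div, Complex.inv_cpow _ _
      (by rw [Complex.arg_ofReal_of_nonneg hb.le]; exact pi_ne_zero.symm), ← Complex.cpow_neg] at h1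
    rw [← h1]
    refine setIntegral_congr_fun measurableSet_Ioi fun t ht => ?_
    have ht : 0 < t := ht
    rw [Complex.ofReal_cpow ht.le]
    push_cast
    rfl
  have hpre : IsPreconnected {r : ℂ | 0 < r.re} :=
    (convex_halfSpace_re_gt 0).isPreconnected
  refine (hG.analyticOnNhd hopen).eqOn_of_preconnected_of_frequently_eq
    (hH.analyticOnNhd hopen) hpre (z₀ := 1) (by simp) ?_ hr
  have htend : Tendsto (fun n : ℕ => ((1 + 1 / ((n : ℝ) + 1) : ℝ) : ℂ)) atTop (𝓝[≠] 1) := by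
    refine tendsto_nhdsWithin_iff.2 ⟨?_, Eventually.of_forall fun n => ?_⟩
    · have : Tendsto (fun n : ℕ => (1 + 1 / ((n : ℝ) + 1) : ℝ)) atTop (𝓝 (1 + 0)) :=
        tendsto_const_nhds.add tendsto_one_div_add_atTop_nhds_zero_nat
      rw [add_zero] at this
      exact (Complex.continuous_ofReal.tendsto' 1 1 Complex.ofReal_one).comp this
    · have : (0 : ℝ) < 1 / ((n : ℝ) + 1) := by positivity
      intro h
      have h2 : ((1 + 1 / ((n : ℝ) + 1) : ℝ)) = 1 := Complex.ofReal_eq_one.1 h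
      linarith
  exact htend.frequently (Frequently.of_forall fun n => hreal _ (by positivity))

/-- The reflection formula in a form that also holds at the poles of `Γ`. -/
lemma inv_Gamma_one_sub {s : ℝ} (hs : 0 < s) :
    (Real.Gamma (1 - s))⁻¹ = Real.Gamma s * Real.sin (π * s) / π := by
  have h := Real.Gamma_mul_Gamma_one_sub s
  have hg := (Real.Gamma_pos_of_pos hs).ne'
  by_cases h0 : Real.sin (π * s) = 0
  · rw [h0, div_zero] at h
    rw [h0, (mul_eq_zero.1 h).resolve_left hg]
    simp
  · have h1 : Real.Gamma (1 - s) ≠ 0 := by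
      intro h1
      rw [h1, mul_zero] at h
      exact div_ne_zero pi_ne_zero h0 h.symm
    have := pi_ne_zero
    rw [eq_div_iff h0] at h
    rw [eq_div_iff this, inv_mul_eq_iff_eq_mul₀ h1]
    linarith

/-- The integrand `e^{στ - xσ^β} σ^{-δ}` of the Bromwich representation of Wright functions. -/
noncomputable def wrightKernel (β δ x τ : ℝ) (σ : ℂ) : ℂ :=
  Complex.exp (σ * τ - x * σ ^ (β : ℂ)) * σ ^ (-δ : ℂ)

/-- The upper half of the Bromwich integral along the vertical line of abscissa `c`. -/
noncomputable def wrightBromwich (β δ x τ c : ℝ) : ℂ :=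
  ∫ y in Ioi (0 : ℝ), wrightKernel β δ x τ (c + y * Complex.I)

/-- Decay rate of `wrightKernel` on vertical lines. -/
noncomputable def wrightRate (β : ℝ) : ℝ := Real.cos (β * (π / 2)) / 2

lemma wrightRate_pos {β : ℝ} (hβ0 : 0 < β) (hβ1 : β < 1) : 0 < wrightRate β := by
  have := pi_pos
  refine div_pos (Real.cos_pos_of_mem_Ioo ⟨by nlinarith, by nlinarith⟩) two_pos

lemma cos_mul_norm_rpow_le_re_cpow {β : ℝ} (hβ0 : 0 < β) (hβ1 : β < 1) {σ : ℂ} (hσ : 0 ≤ σ.re) :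
    Real.cos (β * (π / 2)) * ‖σ‖ ^ β ≤ (σ ^ (β : ℂ)).re := by
  rw [Complex.cpow_ofReal_re, mul_comm]
  refine mul_le_mul_of_nonneg_left ?_ (by positivity)
  have h := Complex.abs_arg_le_pi_div_two_iff.2 hσ
  rw [← Real.cos_abs (σ.arg * β), abs_mul, abs_of_pos hβ0, mul_comm]
  refine Real.cos_le_cos_of_nonneg_of_le_pi (by positivity) ?_ (by gcongr)
  have := pi_pos
  nlinarith

lemma norm_wrightKernel_le {β δ x : ℝ} (hβ0 : 0 < β) (hβ1 : β < 1) (hδ : 0 ≤ δ) (hx : 0 ≤ x)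
    (τ : ℝ) {c y : ℝ} (hc : 0 ≤ c) (hy : 0 < y) :
    ‖wrightKernel β δ x τ (c + y * Complex.I)‖ ≤
      Real.exp (c * τ - x * wrightRate β * c ^ β) *
        (y ^ (-δ) * Real.exp (-(x * wrightRate β) * y ^ β)) := by
  have hκ := wrightRate_pos hβ0 hβ1
  set σ : ℂ := c + y * Complex.I with hσ
  have hre : σ.re = c := by simp [hσ]
  have him : σ.im = y := by simp [hσ]
  have hcn : c ≤ ‖σ‖ := by simpa [hre] using Complex.re_le_norm σ
  have hyn : y ≤ ‖σ‖ := by simpa [him] using Complex.im_le_norm σ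
  have h1 := cos_mul_norm_rpow_le_re_cpow hβ0 hβ1 (σ := σ) (by rw [hre]; exact hc)
  have h2 : c ^ β ≤ ‖σ‖ ^ β := by gcongr
  have h3 : y ^ β ≤ ‖σ‖ ^ β := by gcongr
  have h4 : wrightRate β * c ^ β + wrightRate β * y ^ β ≤ (σ ^ (β : ℂ)).re := by
    have : Real.cos (β * (π / 2)) = 2 * wrightRate β := by rw [wrightRate]; ring
    rw [this] at h1
    nlinarith
  have h5 : ‖σ‖ ^ (-δ) ≤ y ^ (-δ) := Real.rpow_le_rpow_of_nonpos hy hyn (by linarith)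
  have h6 : (σ * τ - x * σ ^ (β : ℂ)).re = c * τ - x * (σ ^ (β : ℂ)).re := by
    simp [hre]
  rw [wrightKernel, norm_mul, Complex.norm_exp, h6,
    show (-δ : ℂ) = ((-δ : ℝ) : ℂ) by push_cast; rfl, Complex.norm_cpow_real,
    mul_left_comm, ← Real.exp_add, mul_comm]
  gcongr
  nlinarith

lemma differentiableAt_wrightKernel (β δ x τ : ℝ) {σ : ℂ} (hσ : 0 < σ.re) :
    DifferentiableAt ℂ (wrightKernel β δ x τ) σ := by
  have hs : σ ∈ Complex.slitPlane := Or.inl hσ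
  unfold wrightKernel
  exact ((differentiableAt_id.mul_const _).sub
    ((differentiableAt_id.cpow_const hs).const_mul _)).cexp.mul (differentiableAt_id.cpow_const hs)

lemma integrableOn_wrightKernel_bound {β δ x : ℝ} (hβ0 : 0 < β) (hβ1 : β < 1) (hδ1 : δ < 1)
    (hx : 0 < x) :
    IntegrableOn (fun y : ℝ => y ^ (-δ) * Real.exp (-(x * wrightRate β) * y ^ β)) (Ioi 0) :=
  integrableOn_rpow_mul_exp_neg_mul_rpow_Ioi hβ0 (by linarith)
    (mul_pos hx (wrightRate_pos hβ0 hβ1))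

lemma measurable_wrightKernel_comp_line (β δ x τ c : ℝ) :
    Measurable fun y : ℝ => wrightKernel β δ x τ (c + y * Complex.I) := by
  unfold wrightKernel
  fun_prop

lemma integrableOn_wrightKernel {β δ x : ℝ} (hβ0 : 0 < β) (hβ1 : β < 1) (hδ : 0 ≤ δ)
    (hδ1 : δ < 1) (hx : 0 < x) (τ : ℝ) {c : ℝ} (hc : 0 ≤ c) :
    IntegrableOn (fun y : ℝ => wrightKernel β δ x τ (c + y * Complex.I)) (Ioi 0) := by
  refine ((integrableOn_wrightKernel_bound hβ0 hβ1 hδ1 hx).const_mul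
    (Real.exp (c * τ - x * wrightRate β * c ^ β))).mono'
    (measurable_wrightKernel_comp_line ..).aestronglyMeasurable ?_
  exact (ae_restrict_iff' measurableSet_Ioi).2
    (ae_of_all _ fun y hy => norm_wrightKernel_le hβ0 hβ1 hδ hx.le τ hc hy)

lemma norm_wrightBromwich_le {β δ x : ℝ} (hβ0 : 0 < β) (hβ1 : β < 1) (hδ : 0 ≤ δ)
    (hδ1 : δ < 1) (hx : 0 < x) (τ : ℝ) {c : ℝ} (hc : 0 ≤ c) :
    ‖wrightBromwich β δ x τ c‖ ≤ Real.exp (c * τ - x * wrightRate β * c ^ β) *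
      ∫ y in Ioi (0 : ℝ), y ^ (-δ) * Real.exp (-(x * wrightRate β) * y ^ β) := by
  rw [← integral_const_mul]
  refine norm_integral_le_of_norm_le
    ((integrableOn_wrightKernel_bound hβ0 hβ1 hδ1 hx).const_mul _) ?_
  exact (ae_restrict_iff' measurableSet_Ioi).2
    (ae_of_all _ fun y hy => norm_wrightKernel_le hβ0 hβ1 hδ hx.le τ hc hy)

lemma wrightKernel_ofReal (β δ x τ : ℝ) {r : ℝ} (hr : 0 ≤ r) :
    wrightKernel β δ x τ r =
      ((Real.exp (r * τ - x * r ^ β) * r ^ (-δ) : ℝ) : ℂ) := by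
  rw [wrightKernel]
  push_cast [Complex.ofReal_cpow hr]
  rfl

lemma tendsto_wrightKernel_bound {β δ x : ℝ} (hβ0 : 0 < β) (hβ1 : β < 1) (hδ : 0 ≤ δ)
    (hx : 0 < x) :
    Tendsto (fun y : ℝ => y ^ (-δ) * Real.exp (-(x * wrightRate β) * y ^ β)) atTop (𝓝 0) := by
  have hκ := mul_pos hx (wrightRate_pos hβ0 hβ1)
  have h : Tendsto (fun y : ℝ => Real.exp (-(x * wrightRate β) * y ^ β)) atTop (𝓝 0) := by
    refine Real.tendsto_exp_atBot.comp ?_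
    exact (tendsto_rpow_atTop hβ0).const_mul_atTop_of_neg (by linarith)
  refine squeeze_zero' ?_ ?_ h
  · filter_upwards [eventually_ge_atTop 0] with y hy
    positivity
  · filter_upwards [eventually_ge_atTop 1] with y hy
    refine mul_le_of_le_one_left (by positivity) ?_
    exact Real.rpow_le_one_of_one_le_of_nonpos hy (by linarith)

/-- The real part of the Bromwich integral does not depend on the abscissa. -/
lemma re_wrightBromwich_eq {β δ x : ℝ} (hβ0 : 0 < β) (hβ1 : β < 1) (hδ : 0 ≤ δ)
    (hδ1 : δ < 1) (hx : 0 < x) (τ : ℝ) {c d : ℝ} (hc : 0 < c) (hcd : c ≤ d) :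
    (wrightBromwich β δ x τ c).re = (wrightBromwich β δ x τ d).re := by
  set K := wrightKernel β δ x τ
  have hκ := wrightRate_pos hβ0 hβ1
  have key : ∀ Y : ℝ, 0 < Y →
      |(∫ y in (0 : ℝ)..Y, K (d + y * Complex.I)).re -
        (∫ y in (0 : ℝ)..Y, K (c + y * Complex.I)).re| ≤
      Real.exp (d * |τ|) * (Y ^ (-δ) * Real.exp (-(x * wrightRate β) * Y ^ β)) * |d - c| := by
    intro Y hY
    have h := Complex.integral_boundary_rect_eq_zero_of_differentiableOn K (c : ℂ)
      (d + Y * Complex.I) (by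
        intro z hz
        refine (differentiableAt_wrightKernel β δ x τ ?_).differentiableWithinAt
        have h1 := hz.1
        simp [uIcc_of_le hcd] at h1
        linarith)
    have hreal : (∫ r : ℝ in c..d, K (r + (0 : ℝ) * Complex.I)).im = 0 := by
      have : (∫ r : ℝ in c..d, K (r + (0 : ℝ) * Complex.I)) =
          ∫ r : ℝ in c..d, ((Real.exp (r * τ - x * r ^ β) * r ^ (-δ) : ℝ) : ℂ) := by
        refine intervalIntegral.integral_congr fun r hr => ?_
        rw [uIcc_of_le hcd] at hr
        have := wrightKernel_ofReal β δ x τ (hc.le.trans hr.1)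
        simpa [K] using this
      rw [this, intervalIntegral.integral_ofReal, Complex.ofReal_im]
    have htop : ‖∫ r : ℝ in c..d, K (r + Y * Complex.I)‖ ≤
        Real.exp (d * |τ|) * (Y ^ (-δ) * Real.exp (-(x * wrightRate β) * Y ^ β)) * |d - c| := by
      refine intervalIntegral.norm_integral_le_of_norm_le_const fun r hr => ?_
      rw [uIoc_of_le hcd] at hr
      have hr0 : 0 < r := hc.trans hr.1
      refine (norm_wrightKernel_le hβ0 hβ1 hδ hx.le τ hr0.le hY).trans ?_
      gcongr
      have h1 : 0 ≤ x * wrightRate β * r ^ β := by positivity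
      have h2 : r * τ ≤ d * |τ| :=
        (mul_le_mul_of_nonneg_left (le_abs_self τ) hr0.le).trans
          (mul_le_mul_of_nonneg_right hr.2 (abs_nonneg τ))
      linarith
    simp only [Complex.ofReal_re, Complex.ofReal_im, Complex.add_re, Complex.add_im,
      Complex.mul_re, Complex.mul_im, Complex.I_re, Complex.I_im, mul_zero, mul_one,
      sub_zero, add_zero, zero_add] at h
    have him := congrArg Complex.im h
    simp only [Complex.sub_im, Complex.add_im, smul_eq_mul, Complex.mul_im, Complex.I_re,
      Complex.I_im, zero_mul, one_mul, zero_add, Complex.zero_im] at him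
    simp only [hreal] at him
    have : (∫ y in (0 : ℝ)..Y, K (d + y * Complex.I)).re -
        (∫ y in (0 : ℝ)..Y, K (c + y * Complex.I)).re =
        (∫ r : ℝ in c..d, K (r + Y * Complex.I)).im := by linarith
    rw [this]
    exact (Complex.abs_im_le_norm _).trans htop
  have hlim : ∀ a : ℝ, 0 < a → Tendsto (fun Y : ℝ => (∫ y in (0 : ℝ)..Y, K (a + y * Complex.I)).re)
      atTop (𝓝 (wrightBromwich β δ x τ a).re) := fun a ha =>
    (Complex.continuous_re.tendsto _).comp (intervalIntegral_tendsto_integral_Ioi 0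
      (integrableOn_wrightKernel hβ0 hβ1 hδ hδ1 hx τ ha.le) tendsto_id)
  have h1 := ((hlim d (hc.trans_le hcd)).sub (hlim c hc)).abs
  have h2 : Tendsto (fun Y : ℝ => Real.exp (d * |τ|) *
      (Y ^ (-δ) * Real.exp (-(x * wrightRate β) * Y ^ β)) * |d - c|) atTop (𝓝 0) := by
    simpa using ((tendsto_wrightKernel_bound hβ0 hβ1 hδ hx).const_mul
      (Real.exp (d * |τ|))).mul_const |d - c|
  have h3 := le_of_tendsto_of_tendsto h1 h2
    ((eventually_gt_atTop 0).mono fun Y hY => key Y hY)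
  have h4 := abs_eq_zero.1 (le_antisymm h3 (abs_nonneg _))
  linarith

lemma re_wrightBromwich_eq_re_zero {β δ x : ℝ} (hβ0 : 0 < β) (hβ1 : β < 1) (hδ : 0 ≤ δ)
    (hδ1 : δ < 1) (hx : 0 < x) (τ : ℝ) {c : ℝ} (hc : 0 < c) :
    (wrightBromwich β δ x τ c).re = (wrightBromwich β δ x τ 0).re := by
  have hκ := wrightRate_pos hβ0 hβ1
  have hlim : Tendsto (fun a : ℝ => wrightBromwich β δ x τ a) (𝓝[>] 0)
      (𝓝 (wrightBromwich β δ x τ 0)) := by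
    refine tendsto_integral_filter_of_dominated_convergence
      (fun y : ℝ => Real.exp |τ| * (y ^ (-δ) * Real.exp (-(x * wrightRate β) * y ^ β)))
      (Eventually.of_forall fun a => (measurable_wrightKernel_comp_line ..).aestronglyMeasurable) ?_
      ((integrableOn_wrightKernel_bound hβ0 hβ1 hδ1 hx).const_mul _) ?_
    · filter_upwards [Ioo_mem_nhdsGT (zero_lt_one' ℝ)] with a ha
      refine (ae_restrict_iff' measurableSet_Ioi).2 (ae_of_all _ fun y hy => ?_)
      have hy : 0 < y := hy
      have ha0 : 0 < a := ha.1
      refine (norm_wrightKernel_le hβ0 hβ1 hδ hx.le τ ha.1.le hy).trans ?_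
      gcongr
      have h1 : 0 ≤ x * wrightRate β * a ^ β := by positivity
      have h2 : a * τ ≤ 1 * |τ| :=
        (mul_le_mul_of_nonneg_left (le_abs_self τ) ha.1.le).trans
          (mul_le_mul_of_nonneg_right ha.2.le (abs_nonneg τ))
      linarith
    · refine (ae_restrict_iff' measurableSet_Ioi).2 (ae_of_all _ fun y hy => ?_)
      have hy : 0 < y := hy
      refine tendsto_nhdsWithin_of_tendsto_nhds ?_
      refine ContinuousAt.tendsto (f := fun a : ℝ => wrightKernel β δ x τ (a + y * Complex.I)) ?_
      have hs : ((0 : ℝ) : ℂ) + y * Complex.I ∈ Complex.slitPlane := Or.inr (by simp [hy.ne'])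
      unfold wrightKernel
      have hl : ContinuousAt (fun a : ℝ => (a : ℂ) + y * Complex.I) 0 := by fun_prop
      have h1 : ContinuousAt (fun a : ℝ => ((a : ℂ) + y * Complex.I) ^ (β : ℂ)) 0 :=
        hl.cpow continuousAt_const hs
      have h2 : ContinuousAt (fun a : ℝ => ((a : ℂ) + y * Complex.I) ^ (-δ : ℂ)) 0 :=
        hl.cpow continuousAt_const hs
      fun_prop
  have h := (Complex.continuous_re.tendsto _).comp hlim
  refine tendsto_nhds_unique (tendsto_const_nhds.congr' ?_) h
  filter_upwards [Ioo_mem_nhdsGT hc] with a ha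
  exact (re_wrightBromwich_eq hβ0 hβ1 hδ hδ1 hx τ ha.1 ha.2.le).symm

lemma re_wrightBromwich_eq_zero {β δ x τ : ℝ} (hβ0 : 0 < β) (hβ1 : β < 1) (hδ : 0 ≤ δ)
    (hδ1 : δ < 1) (hx : 0 < x) (hτ : τ ≤ 0) {c : ℝ} (hc : 0 < c) :
    (wrightBromwich β δ x τ c).re = 0 := by
  have hκ := mul_pos hx (wrightRate_pos hβ0 hβ1)
  set J := ∫ y in Ioi (0 : ℝ), y ^ (-δ) * Real.exp (-(x * wrightRate β) * y ^ β)
  have hJ : 0 ≤ J := setIntegral_nonneg measurableSet_Ioi fun y (hy : 0 < y) => by positivity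
  have h : Tendsto (fun d : ℝ => Real.exp (-(x * wrightRate β) * d ^ β) * J) atTop (𝓝 0) := by
    have : Tendsto (fun d : ℝ => Real.exp (-(x * wrightRate β) * d ^ β)) atTop (𝓝 0) :=
      Real.tendsto_exp_atBot.comp
        ((tendsto_rpow_atTop hβ0).const_mul_atTop_of_neg (by linarith))
    simpa using this.mul_const J
  refine abs_eq_zero.1 (le_antisymm (ge_of_tendsto h ?_) (abs_nonneg _))
  filter_upwards [eventually_ge_atTop c] with d hd
  rw [re_wrightBromwich_eq hβ0 hβ1 hδ hδ1 hx τ hc hd]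
  refine (Complex.abs_re_le_norm _).trans
    ((norm_wrightBromwich_le hβ0 hβ1 hδ hδ1 hx τ (hc.le.trans hd)).trans ?_)
  gcongr
  have := mul_nonneg (hc.le.trans hd) (neg_nonneg.2 hτ)
  linarith

lemma ofReal_mul_exp_cpow {r φ : ℝ} (hr : 0 < r) (h1 : -π < φ) (h2 : φ ≤ π) (a : ℝ) :
    ((r : ℂ) * Complex.exp (φ * Complex.I)) ^ (a : ℂ) =
      ((r ^ a : ℝ) : ℂ) * Complex.exp (a * φ * Complex.I) := by
  have hr' : (r : ℂ) ≠ 0 := by exact_mod_cast hr.ne'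
  rw [Complex.cpow_def_of_ne_zero (mul_ne_zero hr' (Complex.exp_ne_zero _)),
    Complex.log_ofReal_mul hr (Complex.exp_ne_zero _), Complex.log_exp (by simpa using h1)
    (by simpa using h2), Real.rpow_def_of_pos hr, Complex.ofReal_exp, ← Complex.exp_add]
  congr 1
  push_cast
  ring

lemma exists_rpow_le_mul_add {β ε : ℝ} (hβ0 : 0 < β) (hβ1 : β < 1) (hε : 0 < ε) :
    ∃ C : ℝ, ∀ r : ℝ, 0 < r → r ^ β ≤ ε * r + C := by
  have h := (tendsto_rpow_neg_atTop (show 0 < 1 - β by linarith)).eventually (ge_mem_nhds hε)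
  obtain ⟨R, hR⟩ := eventually_atTop.1 (h.and (eventually_ge_atTop 0))
  refine ⟨R ^ β, fun r hr => ?_⟩
  have hR0 : 0 ≤ R := (hR R le_rfl).2
  rcases le_total R r with h | h
  · have h1 := (hR r h).1
    have h2 : r ^ β = r ^ (-(1 - β)) * r := by
      rw [← Real.rpow_add_one hr.ne']; congr 1; ring
    have : 0 ≤ R ^ β := by positivity
    nlinarith
  · have : r ^ β ≤ R ^ β := by gcongr
    nlinarith

/-- The integrand of the Hankel-type representation of Wright functions on the ray of
argument `θ`. -/
noncomputable def wrightRay (β δ x τ θ r : ℝ) : ℂ :=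
  Complex.exp (τ * r * Complex.exp (θ * Complex.I)) * Complex.exp ((1 - δ : ℝ) * θ * Complex.I) *
    ((r ^ (-δ) : ℝ) : ℂ) * Complex.exp (-x * ((r ^ β : ℝ) : ℂ) * Complex.exp (β * θ * Complex.I))

lemma re_ofReal_mul_exp (a θ : ℝ) :
    ((a : ℂ) * Complex.exp (θ * Complex.I)).re = a * Real.cos θ := by
  rw [Complex.re_ofReal_mul, Complex.exp_ofReal_mul_I_re]

lemma hasSum_wrightRay {β δ x τ θ : ℝ} (hβ0 : 0 < β) (hβ1 : β < 1) (hδ1 : δ < 1) (hx : 0 < x)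
    (hτ : 0 < τ) (hθ : π / 2 < θ) (hθ' : θ ≤ π) :
    HasSum (fun k : ℕ => (-x) ^ k / ((Nat.factorial k : ℝ) * Real.Gamma (δ - β * k)) *
      τ ^ (-(1 - δ + β * k))) ((∫ r in Ioi (0 : ℝ), wrightRay β δ x τ θ r).im / π) := by
  have hcos : Real.cos θ < 0 :=
    Real.cos_neg_of_pi_div_two_lt_of_lt hθ (by linarith [pi_pos])
  set b : ℝ := -(τ * Real.cos θ) with hb
  have hb0 : 0 < b := by nlinarith
  set F : ℕ → ℝ → ℂ := fun k r =>
    Complex.exp (τ * r * Complex.exp (θ * Complex.I)) *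
      Complex.exp ((1 - δ : ℝ) * θ * Complex.I) * ((r ^ (-δ) : ℝ) : ℂ) *
      ((-x * ((r ^ β : ℝ) : ℂ) * Complex.exp (β * θ * Complex.I)) ^ k / (Nat.factorial k : ℂ))
    with hF
  have hnorm : ∀ r : ℝ, ‖Complex.exp (τ * r * Complex.exp (θ * Complex.I))‖ =
      Real.exp (-(b * r)) := by
    intro r
    rw [Complex.norm_exp, ← Complex.ofReal_mul, re_ofReal_mul_exp, hb]
    ring_nf
  have hsum : HasSum (fun k => ∫ r in Ioi (0 : ℝ), F k r)
      (∫ r in Ioi (0 : ℝ), wrightRay β δ x τ θ r) := by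
    have hbs : ∀ r : ℝ, HasSum (fun k : ℕ => Real.exp (-(b * r)) * r ^ (-δ) *
        ((x * r ^ β) ^ k / (Nat.factorial k : ℝ)))
        (Real.exp (-(b * r)) * r ^ (-δ) * Real.exp (x * r ^ β)) := fun r => by
      have := NormedSpace.expSeries_div_hasSum_exp (𝔸 := ℝ) (x * r ^ β)
      rw [← Real.exp_eq_exp_ℝ] at this
      exact this.mul_left _
    refine hasSum_integral_of_dominated_convergence
      (fun k r => Real.exp (-(b * r)) * r ^ (-δ) * ((x * r ^ β) ^ k / (Nat.factorial k : ℝ)))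
      (fun k => by fun_prop) (fun k => ?_) (ae_of_all _ fun r => (hbs r).summable) ?_ ?_
    · refine (ae_restrict_iff' measurableSet_Ioi).2 (ae_of_all _ fun r hr => ?_)
      have hr : 0 < r := hr
      have h1 : ‖Complex.exp ((1 - δ : ℝ) * θ * Complex.I)‖ = 1 := by
        rw [← Complex.ofReal_mul, Complex.norm_exp_ofReal_mul_I]
      have h2 : ‖Complex.exp (β * θ * Complex.I)‖ = 1 := by
        rw [← Complex.ofReal_mul, Complex.norm_exp_ofReal_mul_I]
      simp only [hF, norm_mul, norm_div, norm_pow, hnorm, h1, h2, norm_neg, Complex.norm_real,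
        Complex.norm_natCast, mul_one]
      rw [Real.norm_of_nonneg hx.le, Real.norm_of_nonneg (by positivity : 0 ≤ r ^ β),
        Real.norm_of_nonneg (by positivity : 0 ≤ r ^ (-δ))]
    · simp_rw [fun r => (hbs r).tsum_eq]
      obtain ⟨C, hC⟩ := exists_rpow_le_mul_add hβ0 hβ1 (show 0 < b / 2 / x by positivity)
      refine ((integrableOn_rpow_mul_exp_neg_mul_Ioi (s := 1 - δ) (b := b / 2) (by linarith)
        (by positivity)).const_mul (Real.exp (x * C))).mono' (by fun_prop) ?_
      refine (ae_restrict_iff' measurableSet_Ioi).2 (ae_of_all _ fun r hr => ?_)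
      have hr : 0 < r := hr
      rw [Real.norm_of_nonneg (by positivity), show 1 - δ - 1 = -δ by ring,
        mul_right_comm (Real.exp (-(b * r))), ← Real.exp_add, mul_left_comm (Real.exp (x * C)),
        ← Real.exp_add, mul_comm (Real.exp _)]
      refine mul_le_mul_of_nonneg_left (Real.exp_le_exp.2 ?_) (by positivity)
      have := mul_le_mul_of_nonneg_left (hC r hr) hx.le
      have h3 : x * (b / 2 / x * r + C) = b / 2 * r + x * C := by field_simp
      linarith
    · refine ae_of_all _ fun r => ?_
      have := NormedSpace.expSeries_div_hasSum_exp (𝔸 := ℂ)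
        (-x * ((r ^ β : ℝ) : ℂ) * Complex.exp (β * θ * Complex.I))
      rw [← Complex.exp_eq_exp_ℂ] at this
      exact this.mul_left _
  have hterm : ∀ k : ℕ, (∫ r in Ioi (0 : ℝ), F k r).im / π =
      (-x) ^ k / ((Nat.factorial k : ℝ) * Real.Gamma (δ - β * k)) * τ ^ (-(1 - δ + β * k)) := by
    intro k
    set s : ℝ := 1 - δ + β * k with hs
    have hs0 : 0 < s := by
      have : 0 ≤ β * k := by positivity
      linarith
    have hw : (τ : ℂ) * Complex.exp ((θ - π : ℝ) * Complex.I) =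
        -(τ * Complex.exp (θ * Complex.I)) := by
      rw [Complex.ofReal_sub, sub_mul, Complex.exp_sub, Complex.exp_pi_mul_I]
      ring
    have hint := integral_rpow_mul_cexp_neg_mul_Ioi hs0
      (r := (τ : ℂ) * Complex.exp ((θ - π : ℝ) * Complex.I)) (by
        rw [hw, Complex.neg_re, re_ofReal_mul_exp]
        exact hb0)
    rw [show (-s : ℂ) = ((-s : ℝ) : ℂ) by push_cast; rfl,
      ofReal_mul_exp_cpow hτ (by linarith) (by linarith), hw] at hint
    have hFk : ∫ r in Ioi (0 : ℝ), F k r =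
        ((-x) ^ k / (Nat.factorial k : ℂ) * Complex.exp (s * θ * Complex.I)) *
        ∫ r in Ioi (0 : ℝ), ((r ^ (s - 1) : ℝ) : ℂ) *
          Complex.exp (-(-(τ * Complex.exp (θ * Complex.I)) * r)) := by
      rw [← integral_const_mul]
      refine setIntegral_congr_fun measurableSet_Ioi fun r hr => ?_
      have hr : 0 < r := hr
      have h1 : r ^ (s - 1) = r ^ (-δ) * (r ^ β) ^ k := by
        rw [← Real.rpow_natCast, ← Real.rpow_mul hr.le, ← Real.rpow_add hr]
        congr 1
        rw [hs]; ring
      have h2 : Complex.exp (s * θ * Complex.I) = Complex.exp ((1 - δ : ℝ) * θ * Complex.I) *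
          Complex.exp (β * θ * Complex.I) ^ k := by
        rw [← Complex.exp_nat_mul, ← Complex.exp_add]
        congr 1
        rw [hs]; push_cast; ring
      have h3 : -(-(τ * Complex.exp (θ * Complex.I)) * (r : ℂ)) =
          τ * r * Complex.exp (θ * Complex.I) := by ring
      simp only [hF]
      rw [h1, h2, h3]
      push_cast
      ring
    have hphase : Complex.exp (s * θ * Complex.I) *
        Complex.exp ((-s : ℝ) * (θ - π : ℝ) * Complex.I) = Complex.exp ((π * s : ℝ) * Complex.I) := by
      rw [← Complex.exp_add]
      congr 1
      push_cast
      ring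
    have hval : ∫ r in Ioi (0 : ℝ), F k r =
        (((-x) ^ k / (Nat.factorial k : ℝ) * τ ^ (-s) * Real.Gamma s : ℝ) : ℂ) *
          Complex.exp ((π * s : ℝ) * Complex.I) := by
      rw [hFk, hint, ← hphase]
      push_cast
      ring
    rw [hval, Complex.im_ofReal_mul, Complex.exp_ofReal_mul_I_im,
      show δ - β * k = 1 - s by rw [hs]; ring, div_mul_eq_div_div, div_eq_mul_inv _ (Real.Gamma _),
      inv_Gamma_one_sub hs0]
    ring
  have := (Complex.hasSum_im hsum).div_const π
  simpa only [hterm] using this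

lemma tendsto_integral_wrightRay {β δ x τ : ℝ} (hβ0 : 0 < β) (hβ1 : β < 1) (hδ1 : δ < 1)
    (hx : 0 < x) (hτ : 0 < τ) :
    Tendsto (fun θ => ∫ r in Ioi (0 : ℝ), wrightRay β δ x τ θ r) (𝓝[>] (π / 2))
      (𝓝 (∫ r in Ioi (0 : ℝ), wrightRay β δ x τ (π / 2) r)) := by
  have hπ := pi_pos
  set θ₀ : ℝ := π / 4 * (1 + β⁻¹) with hθ₀
  have hβθ : β * θ₀ = π / 4 * (β + 1) := by rw [hθ₀]; field_simp
  have hinv : 1 < β⁻¹ := (one_lt_inv₀ hβ0).2 hβ1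
  have hκ : 0 < Real.cos (β * θ₀) :=
    Real.cos_pos_of_mem_Ioo ⟨by rw [hβθ]; nlinarith, by rw [hβθ]; nlinarith⟩
  refine tendsto_integral_filter_of_dominated_convergence
    (fun r => r ^ (-δ) * Real.exp (-(x * Real.cos (β * θ₀)) * r ^ β))
    (Eventually.of_forall fun θ => by unfold wrightRay; fun_prop) ?_
    (integrableOn_rpow_mul_exp_neg_mul_rpow_Ioi hβ0 (by linarith) (by positivity)) ?_
  · filter_upwards [Ioo_mem_nhdsGT (show π / 2 < θ₀ by rw [hθ₀]; nlinarith),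
      Ioo_mem_nhdsGT (show π / 2 < π by linarith)] with θ hθ hθ'
    refine (ae_restrict_iff' measurableSet_Ioi).2 (ae_of_all _ fun r hr => ?_)
    have hr : 0 < r := hr
    have h1 : ‖Complex.exp ((1 - δ : ℝ) * θ * Complex.I)‖ = 1 := by
      rw [← Complex.ofReal_mul, Complex.norm_exp_ofReal_mul_I]
    have hcos : Real.cos θ < 0 :=
      Real.cos_neg_of_pi_div_two_lt_of_lt hθ.1 (by linarith [hθ'.2])
    have h2 : ‖Complex.exp (τ * r * Complex.exp (θ * Complex.I))‖ ≤ 1 := by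
      rw [Complex.norm_exp, ← Complex.ofReal_mul, re_ofReal_mul_exp, Real.exp_le_one_iff]
      have : 0 < τ * r := by positivity
      nlinarith
    have h3 : ‖Complex.exp (-x * ((r ^ β : ℝ) : ℂ) * Complex.exp (β * θ * Complex.I))‖ ≤
        Real.exp (-(x * Real.cos (β * θ₀)) * r ^ β) := by
      rw [Complex.norm_exp, Real.exp_le_exp, ← Complex.ofReal_neg, ← Complex.ofReal_mul,
        ← Complex.ofReal_mul β, re_ofReal_mul_exp]
      have h4 : Real.cos (β * θ₀) ≤ Real.cos (β * θ) :=
        Real.cos_le_cos_of_nonneg_of_le_pi (mul_nonneg hβ0.le (by linarith [hθ.1]))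
          (by rw [hβθ]; nlinarith) (mul_le_mul_of_nonneg_left hθ.2.le hβ0.le)
      have h5 : 0 < x * r ^ β := by positivity
      nlinarith
    rw [wrightRay, norm_mul, norm_mul, norm_mul, h1, mul_one, Complex.norm_real,
      Real.norm_of_nonneg (by positivity)]
    gcongr
    exact mul_le_of_le_one_left (by positivity) h2
  · refine ae_of_all _ fun r => ?_
    refine tendsto_nhdsWithin_of_tendsto_nhds ?_
    refine ContinuousAt.tendsto (f := fun θ : ℝ => wrightRay β δ x τ θ r) ?_
    unfold wrightRay
    fun_prop

lemma wrightRay_pi_div_two (β δ x τ : ℝ) {r : ℝ} (hr : 0 < r) :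
    wrightRay β δ x τ (π / 2) r =
      Complex.I * wrightKernel β δ x τ ((0 : ℝ) + r * Complex.I) := by
  have hπ := pi_pos
  have h1 : Complex.exp ((π / 2 : ℝ) * Complex.I) = Complex.I := by
    push_cast
    exact Complex.exp_pi_div_two_mul_I
  have h2 : ∀ a : ℝ, ((r : ℂ) * Complex.I) ^ (a : ℂ) =
      ((r ^ a : ℝ) : ℂ) * Complex.exp (a * (π / 2 : ℝ) * Complex.I) := by
    intro a
    rw [← ofReal_mul_exp_cpow hr (by linarith) (by linarith), h1]
  have h3 : Complex.exp ((1 - δ : ℝ) * (π / 2 : ℝ) * Complex.I) =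
      Complex.I * Complex.exp ((-δ : ℝ) * (π / 2 : ℝ) * Complex.I) := by
    nth_rewrite 2 [← h1]
    rw [← Complex.exp_add]
    congr 1
    push_cast
    ring
  rw [wrightRay, wrightKernel, Complex.ofReal_zero, zero_add,
    show (-δ : ℂ) = ((-δ : ℝ) : ℂ) by push_cast; rfl, h2, h2, h1, h3, sub_eq_add_neg,
    Complex.exp_add, show (τ : ℂ) * r * Complex.I = r * Complex.I * τ by ring, neg_mul, neg_mul,
    mul_assoc (x : ℂ)]
  ring

/-- The series of a Wright function in terms of its Bromwich integral. -/
lemma hasSum_wrightBromwich {β δ x τ c : ℝ} (hβ0 : 0 < β) (hβ1 : β < 1) (hδ : 0 ≤ δ)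
    (hδ1 : δ < 1) (hx : 0 < x) (hτ : 0 < τ) (hc : 0 < c) :
    HasSum (fun k : ℕ => (-x) ^ k / ((Nat.factorial k : ℝ) * Real.Gamma (δ - β * k)) *
      τ ^ (-(1 - δ + β * k))) ((wrightBromwich β δ x τ c).re / π) := by
  have hπ := pi_pos
  rw [re_wrightBromwich_eq_re_zero hβ0 hβ1 hδ hδ1 hx τ hc]
  have hS := hasSum_wrightRay hβ0 hβ1 hδ1 hx hτ (θ := π) (by linarith) le_rfl
  have hA : (∫ r in Ioi (0 : ℝ), wrightRay β δ x τ (π / 2) r).im =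
      (wrightBromwich β δ x τ 0).re := by
    rw [setIntegral_congr_fun measurableSet_Ioi
      fun r hr => wrightRay_pi_div_two β δ x τ hr, integral_const_mul, Complex.I_mul_im]
    rfl
  have hlim := ((Complex.continuous_im.tendsto _).comp
    (tendsto_integral_wrightRay hβ0 hβ1 hδ1 hx hτ)).div_const π
  rw [hA] at hlim
  rw [← tendsto_nhds_unique (tendsto_const_nhds.congr' ?_) hlim]
  · exact hS
  · filter_upwards [Ioo_mem_nhdsGT (show π / 2 < π by linarith)] with θ hθ
    exact hS.unique (hasSum_wrightRay hβ0 hβ1 hδ1 hx hτ hθ.1 hθ.2.le)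

/-- The M-Wright function, the time-one profile of `wrightG`. -/
noncomputable def wrightM (β y : ℝ) : ℝ :=
  ∑' k : ℕ, (-y) ^ k / ((Nat.factorial k : ℝ) * Real.Gamma (1 - β * (k + 1)))

lemma wrightG_eq_wrightM (β x t : ℝ) : wrightG β x t = t ^ (-β) * wrightM β (x / t ^ β) := by
  rw [wrightG, wrightM]
  simp only [neg_div]

lemma wrightM_eq_wrightG (β y : ℝ) : wrightM β y = wrightG β y 1 := by
  simp [wrightG_eq_wrightM]

lemma hasSum_wrightG {β x τ c : ℝ} (hβ0 : 0 < β) (hβ1 : β < 1) (hx : 0 < x) (hτ : 0 < τ)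
    (hc : 0 < c) :
    HasSum (fun k : ℕ => τ ^ (-β) *
      ((-x / τ ^ β) ^ k / ((Nat.factorial k : ℝ) * Real.Gamma (1 - β * (k + 1)))))
      ((wrightBromwich β (1 - β) x τ c).re / π) := by
  convert! hasSum_wrightBromwich (δ := 1 - β) hβ0 hβ1 (by linarith) (by linarith) hx hτ hc using 2
    with k
  rw [show 1 - β - β * k = 1 - β * (k + 1) by ring,
    show -(1 - (1 - β) + β * (k : ℝ)) = -β + -(β * k) by ring, Real.rpow_add hτ,
    Real.rpow_neg hτ.le (β * k), Real.rpow_mul hτ.le, Real.rpow_natCast, div_pow]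
  ring

lemma wrightG_eq_wrightBromwich {β x τ c : ℝ} (hβ0 : 0 < β) (hβ1 : β < 1) (hx : 0 < x)
    (hτ : 0 < τ) (hc : 0 < c) :
    wrightG β x τ = (wrightBromwich β (1 - β) x τ c).re / π := by
  rw [wrightG, ← tsum_mul_left, (hasSum_wrightG hβ0 hβ1 hx hτ hc).tsum_eq]

/-- The density with Laplace transform `e^{-xs^β}` in terms of `wrightG`. -/
lemma mul_wrightG_eq_wrightBromwich {β x τ c : ℝ} (hβ0 : 0 < β) (hβ1 : β < 1) (hx : 0 < x)
    (hτ : 0 < τ) (hc : 0 < c) :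
    β * x / τ * wrightG β x τ = (wrightBromwich β 0 x τ c).re / π := by
  have h0 := hasSum_wrightBromwich (δ := 0) hβ0 hβ1 le_rfl one_pos hx hτ hc
  have h1 := (hasSum_nat_add_iff' 1).2 h0
  simp only [Finset.range_one, Finset.sum_singleton, Nat.cast_zero, mul_zero, sub_zero,
    Real.Gamma_zero, div_zero, zero_mul] at h1
  have h2 := (hasSum_wrightG hβ0 hβ1 hx hτ hc).mul_left (β * x / τ)
  rw [wrightG_eq_wrightBromwich hβ0 hβ1 hx hτ hc]
  refine h2.unique ?_
  convert! h1 using 2 with k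
  have hβk : β * ((k : ℝ) + 1) ≠ 0 := by positivity
  have hΓ : Real.Gamma (1 - β * (k + 1)) = -(β * (k + 1)) * Real.Gamma (-(β * (k + 1))) := by
    rw [← Real.Gamma_add_one (neg_ne_zero.2 hβk)]
    congr 1
    ring
  rw [hΓ]
  push_cast
  rw [Nat.factorial_succ, zero_sub,
    show -(1 + β * ((k : ℝ) + 1)) = -β + -(β * k) + -1 by ring, Real.rpow_add hτ,
    Real.rpow_add hτ, Real.rpow_neg hτ.le (β * k), Real.rpow_mul hτ.le, Real.rpow_natCast,
    Real.rpow_neg_one, div_pow]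
  push_cast
  rcases eq_or_ne (Real.Gamma (-(β * ((k : ℝ) + 1)))) 0 with hz | hz
  · simp [hz]
  · field_simp
    ring

lemma measurable_wrightBromwich (β δ c : ℝ) :
    Measurable fun p : ℝ × ℝ => (wrightBromwich β δ p.1 p.2 c).re := by
  have : StronglyMeasurable fun p : ℝ × ℝ => wrightBromwich β δ p.1 p.2 c := by
    refine StronglyMeasurable.integral_prod_right'
      (f := fun q : (ℝ × ℝ) × ℝ => wrightKernel β δ q.1.1 q.1.2 (c + q.2 * Complex.I)) ?_
    unfold wrightKernel
    exact Measurable.stronglyMeasurable (by fun_prop)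
  exact Complex.measurable_re.comp this.measurable

lemma aestronglyMeasurable_wrightM {β : ℝ} (hβ0 : 0 < β) (hβ1 : β < 1) :
    AEStronglyMeasurable (wrightM β) (volume.restrict (Ioi 0)) := by
  have h : Measurable fun y : ℝ => (wrightBromwich β (1 - β) y 1 1).re / π :=
    ((measurable_wrightBromwich β (1 - β) 1).comp
      (measurable_id.prodMk measurable_const)).div_const π
  refine h.aestronglyMeasurable.congr ?_
  refine (ae_restrict_iff' measurableSet_Ioi).2 (ae_of_all _ fun y hy => ?_)
  rw [wrightM_eq_wrightG, wrightG_eq_wrightBromwich hβ0 hβ1 hy one_pos one_pos]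

/-- The M-Wright function decays faster than any exponential. -/
lemma exists_abs_wrightM_le {β : ℝ} (hβ0 : 0 < β) (hβ1 : β < 1) {a : ℝ} (ha : 0 < a) :
    ∃ C : ℝ, 0 < C ∧ ∀ y : ℝ, 0 < y → |wrightM β y| ≤ C * Real.exp (-(a * y)) := by
  have hκ := wrightRate_pos hβ0 hβ1
  have hπ := pi_pos
  set c : ℝ := (a / wrightRate β) ^ β⁻¹ with hc
  have hc0 : 0 < c := by positivity
  have hcβ : wrightRate β * c ^ β = a := by
    rw [hc, ← Real.rpow_mul (by positivity), inv_mul_cancel₀ hβ0.ne', Real.rpow_one]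
    field_simp
  set J : ℝ → ℝ := fun y => ∫ r in Ioi (0 : ℝ), r ^ (-(1 - β)) *
    Real.exp (-(y * wrightRate β) * r ^ β) with hJ
  have hJnn : ∀ y, 0 ≤ J y := fun y =>
    setIntegral_nonneg measurableSet_Ioi fun r (hr : 0 < r) => by positivity
  have hsum := (hasSum_wrightG hβ0 hβ1 (one_pos) one_pos one_pos (β := β)).summable.abs
  set S := ∑' k : ℕ, |(1 : ℝ) ^ (-β) * ((-1 / 1 ^ β) ^ k /
    ((Nat.factorial k : ℝ) * Real.Gamma (1 - β * (k + 1))))| with hS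
  have hS0 : 0 ≤ S := tsum_nonneg fun k => abs_nonneg _
  refine ⟨Real.exp c * J 1 / π + S * Real.exp a + 1, by have := hJnn 1; positivity, fun y hy => ?_⟩
  rcases le_total 1 y with h1 | h1
  · have hJy : J y ≤ J 1 := by
      refine setIntegral_mono_on
        (integrableOn_wrightKernel_bound hβ0 hβ1 (by linarith) hy)
        (integrableOn_wrightKernel_bound hβ0 hβ1 (by linarith) one_pos) measurableSet_Ioi
        fun r (hr : 0 < r) => ?_
      gcongr
    have h2 := norm_wrightBromwich_le (δ := 1 - β) hβ0 hβ1 (by linarith) (by linarith) hy 1 hc0.le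
    rw [wrightM_eq_wrightG, wrightG_eq_wrightBromwich hβ0 hβ1 hy one_pos hc0, abs_div,
      abs_of_pos hπ]
    have h3 : Real.exp (c * 1 - y * wrightRate β * c ^ β) =
        Real.exp c * Real.exp (-(a * y)) := by
      rw [← Real.exp_add]
      congr 1
      rw [← hcβ]; ring
    rw [h3] at h2
    have h4 : |(wrightBromwich β (1 - β) y 1 c).re| ≤ Real.exp c * Real.exp (-(a * y)) * J 1 :=
      (Complex.abs_re_le_norm _).trans (h2.trans (by gcongr))
    calc |(wrightBromwich β (1 - β) y 1 c).re| / π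
        ≤ Real.exp c * Real.exp (-(a * y)) * J 1 / π := by gcongr
      _ = (Real.exp c * J 1 / π) * Real.exp (-(a * y)) := by ring
      _ ≤ _ := by
        gcongr
        have : 0 ≤ S * Real.exp a := by positivity
        linarith
  · have h2 : |wrightM β y| ≤ S := by
      rw [wrightM, ← Real.norm_eq_abs]
      refine tsum_of_norm_bounded hsum.hasSum fun k => ?_
      simp only [Real.one_rpow, div_one, one_mul, Real.norm_eq_abs, abs_div, abs_pow, abs_neg,
        abs_one, one_pow]
      gcongr
      exact pow_le_one₀ (abs_nonneg _) (by rw [abs_of_pos hy]; exact h1)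
    have h3 : Real.exp a * Real.exp (-(a * y)) ≥ 1 := by
      rw [← Real.exp_add]
      refine Real.one_le_exp ?_
      nlinarith
    have h4 : 0 ≤ Real.exp c * J 1 / π := by have := hJnn 1; positivity
    have h5 := Real.exp_pos (-(a * y))
    calc |wrightM β y| ≤ S * 1 := by linarith
      _ ≤ S * (Real.exp a * Real.exp (-(a * y))) := by gcongr
      _ ≤ _ := by nlinarith

lemma integral_rpow_mul_wrightBromwich {β x t : ℝ} (hβ0 : 0 < β) (hβ1 : β < 1) (hx : 0 < x) :
    ∫ u in Ioi (0 : ℝ), u ^ (-β) * (wrightBromwich β 0 x (t - u) 1).re =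
      Real.Gamma (1 - β) * (wrightBromwich β (1 - β) x t 1).re := by
  set σ : ℝ → ℂ := fun y => (1 : ℝ) + y * Complex.I with hσ
  set Φ : ℝ → ℝ → ℂ := fun u y => ((u ^ (-β) : ℝ) : ℂ) * wrightKernel β 0 x (t - u) (σ y) with hΦ
  have hint : Integrable (Function.uncurry Φ)
      ((volume.restrict (Ioi (0 : ℝ))).prod (volume.restrict (Ioi (0 : ℝ)))) := by
    have h1 := integrableOn_rpow_mul_exp_neg_mul_Ioi (s := 1 - β) (b := 1) (by linarith) one_pos
    have h2 := integrableOn_wrightKernel_bound (δ := 0) hβ0 hβ1 one_pos hx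
    refine ((h1.mul_prod h2).const_mul (Real.exp (t - x * wrightRate β))).mono' ?_ ?_
    · refine Measurable.aestronglyMeasurable ?_
      simp only [hΦ, hσ, wrightKernel, Function.uncurry_def]
      fun_prop
    · rw [Measure.prod_restrict]
      refine (ae_restrict_iff' (measurableSet_Ioi.prod measurableSet_Ioi)).2
        (ae_of_all _ fun p hp => ?_)
      have hu : 0 < p.1 := hp.1
      have hy : 0 < p.2 := hp.2
      have h3 := norm_wrightKernel_le hβ0 hβ1 (le_refl (0 : ℝ)) hx.le (t - p.1) zero_le_one hy
      simp only [Function.uncurry_def, hΦ]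
      rw [norm_mul, Complex.norm_real, Real.norm_of_nonneg (by positivity)]
      refine (mul_le_mul_of_nonneg_left h3 (by positivity)).trans_eq ?_
      rw [show 1 * (t - p.1) - x * wrightRate β * 1 ^ β = (t - x * wrightRate β) + -(1 * p.1) by
        rw [Real.one_rpow]; ring, Real.exp_add, show 1 - β - 1 = -β by ring]
      ring
  have hleft : ∫ u in Ioi (0 : ℝ), u ^ (-β) * (wrightBromwich β 0 x (t - u) 1).re =
      (∫ u in Ioi (0 : ℝ), ∫ y in Ioi (0 : ℝ), Φ u y).re := by
    have h := integral_re hint.integral_prod_left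
    simp only [RCLike.re_eq_complex_re] at h
    refine Eq.trans ?_ h
    congr 1
    ext u
    simp only [Function.uncurry_apply_pair, hΦ]
    rw [integral_const_mul, Complex.re_ofReal_mul]
    rfl
  have hright : ∀ y : ℝ, ∫ u in Ioi (0 : ℝ), Φ u y =
      (Real.Gamma (1 - β) : ℂ) * wrightKernel β (1 - β) x t (σ y) := by
    intro y
    have h := integral_rpow_mul_cexp_neg_mul_Ioi (s := 1 - β) (r := σ y) (by linarith)
      (by simp [hσ])
    have h1 : ∀ u : ℝ, Φ u y = Complex.exp (σ y * t - x * σ y ^ (β : ℂ)) *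
        (((u ^ (1 - β - 1) : ℝ) : ℂ) * Complex.exp (-(σ y * u))) := by
      intro u
      simp only [hΦ, wrightKernel]
      rw [show σ y * ((t - u : ℝ) : ℂ) - x * σ y ^ (β : ℂ) =
        (σ y * t - x * σ y ^ (β : ℂ)) + -(σ y * u) by push_cast; ring, Complex.exp_add,
        show 1 - β - 1 = -β by ring, Complex.ofReal_zero, neg_zero, Complex.cpow_zero]
      ring
    simp_rw [h1]
    rw [integral_const_mul, h, wrightKernel]
    ring
  rw [hleft, integral_integral_swap hint]
  simp_rw [hright]
  rw [integral_const_mul, Complex.re_ofReal_mul]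
  rfl

lemma integral_sub_rpow_mul_wrightBromwich {β x t : ℝ} (hβ0 : 0 < β) (hβ1 : β < 1) (hx : 0 < x)
    (ht : 0 < t) :
    ∫ τ in (0 : ℝ)..t, (t - τ) ^ (-β) * ((wrightBromwich β 0 x τ 1).re / π) =
      Real.Gamma (1 - β) * wrightG β x t := by
  have h := intervalIntegral.integral_comp_sub_left (a := 0) (b := t)
    (fun u => u ^ (-β) * ((wrightBromwich β 0 x (t - u) 1).re / π)) t
  simp only [sub_sub_cancel, sub_self, sub_zero] at h
  rw [h, wrightG_eq_wrightBromwich hβ0 hβ1 hx ht one_pos, ← mul_div_assoc,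
    ← integral_rpow_mul_wrightBromwich hβ0 hβ1 hx, intervalIntegral.integral_of_le ht.le,
    ← integral_div]
  simp only [← mul_div_assoc]
  refine (setIntegral_eq_of_subset_of_forall_sdiff_eq_zero measurableSet_Ioi Ioc_subset_Ioi_self
    fun u hu => ?_).symm
  have hu1 : 0 < u := hu.1
  have hu2 : t < u := by
    by_contra! h
    exact hu.2 ⟨hu1, h⟩
  rw [re_wrightBromwich_eq_zero hβ0 hβ1 le_rfl one_pos hx (by linarith) one_pos]
  simp

lemma integral_wrightG_mul {β τ : ℝ} (hτ : 0 < τ) (g : ℝ → ℝ) :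
    ∫ x in Ioi (0 : ℝ), wrightG β x τ * g x =
      ∫ y in Ioi (0 : ℝ), wrightM β y * g (τ ^ β * y) := by
  have hb : 0 < τ ^ β := by positivity
  have h := integral_comp_mul_left_Ioi (fun x => wrightM β (x / τ ^ β) * g x) 0 hb
  simp only [mul_div_cancel_left₀ _ hb.ne', mul_zero, smul_eq_mul] at h
  rw [h, ← integral_const_mul]
  simp only [wrightG_eq_wrightM, Real.rpow_neg hτ.le, mul_assoc]

/-- Differentiation of the Wright-type transform under the integral sign. -/
lemma hasDerivAt_integral_wrightG_mul {β : ℝ} (hβ0 : 0 < β) (hβ1 : β < 1) {f : ℝ → ℝ}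
    (hf : ContDiffOn ℝ 1 f (Ici 0)) (hfe : ExpOrder f) (hfe' : ExpOrder (deriv f)) {τ : ℝ}
    (hτ : 0 < τ) :
    HasDerivAt (fun τ => ∫ x in Ioi (0 : ℝ), wrightG β x τ * f x)
      (∫ x in Ioi (0 : ℝ), β * x / τ * wrightG β x τ * deriv f x) τ := by
  obtain ⟨C₀, a₀, hC₀, ha₀, hf₀⟩ := hfe
  obtain ⟨C₁, a₁, hC₁, ha₁, hf₁⟩ := hfe'
  have hdiff : ∀ x : ℝ, 0 < x → HasDerivAt f (deriv f x) x := fun x hx =>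
    ((hf.contDiffAt (Ici_mem_nhds hx)).differentiableAt one_ne_zero).hasDerivAt
  have hfm : ∀ σ : ℝ, 0 < σ →
      AEStronglyMeasurable (fun y => f (σ ^ β * y)) (volume.restrict (Ioi 0)) := by
    intro σ hσ
    refine ContinuousOn.aestronglyMeasurable ?_ measurableSet_Ioi
    refine hf.continuousOn.comp (by fun_prop) fun y (hy : 0 < y) => ?_
    exact mem_Ici.2 (by positivity)
  have hMm := aestronglyMeasurable_wrightM hβ0 hβ1
  set T : ℝ := (2 * τ) ^ β with hT
  have hT0 : 0 < T := by positivity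
  set L : ℝ := (τ / 2) ^ (β - 1) with hL
  obtain ⟨D₀, hD₀, hM₀⟩ := exists_abs_wrightM_le hβ0 hβ1 (a := a₀ * τ ^ β + 1) (by positivity)
  obtain ⟨D₁, hD₁, hM₁⟩ := exists_abs_wrightM_le hβ0 hβ1 (a := a₁ * T + 1) (by positivity)
  have key := hasDerivAt_integral_of_dominated_loc_of_deriv_le
    (μ := volume.restrict (Ioi (0 : ℝ))) (x₀ := τ) (s := Ioo (τ / 2) (2 * τ))
    (F := fun σ y => wrightM β y * f (σ ^ β * y))
    (F' := fun σ y => wrightM β y * (deriv f (σ ^ β * y) * (β * σ ^ (β - 1) * y)))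
    (bound := fun y => D₁ * C₁ * (β * L) * (y ^ ((2 : ℝ) - 1) * Real.exp (-(1 * y))))
    (Ioo_mem_nhds (by linarith) (by linarith)) ?_ ?_ ?_ ?_ ?_ ?_
  · have h1 : ∀ᶠ σ in 𝓝 τ, ∫ x in Ioi (0 : ℝ), wrightG β x σ * f x =
        ∫ y in Ioi (0 : ℝ), wrightM β y * f (σ ^ β * y) := by
      filter_upwards [Ioi_mem_nhds hτ] with σ hσ
      exact integral_wrightG_mul hσ f
    refine (key.2.congr_of_eventuallyEq h1).congr_deriv ?_
    have h2 := integral_wrightG_mul (β := β) hτ fun x => β * x / τ * deriv f x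
    calc _ = ∫ y in Ioi (0 : ℝ), wrightM β y * (β * (τ ^ β * y) / τ * deriv f (τ ^ β * y)) := by
          congr 1
          ext y
          rw [Real.rpow_sub_one hτ.ne']
          ring
      _ = _ := by
          rw [← h2]
          congr 1
          ext x
          ring
  · filter_upwards [Ioi_mem_nhds hτ] with σ hσ
    exact hMm.mul (hfm σ hσ)
  · have h1 := integrableOn_rpow_mul_exp_neg_mul_Ioi (s := 1) (b := 1) one_pos one_pos
    refine (h1.const_mul (D₀ * C₀)).mono' (hMm.mul (hfm τ hτ)) ?_
    refine (ae_restrict_iff' measurableSet_Ioi).2 (ae_of_all _ fun y (hy : 0 < y) => ?_)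
    rw [norm_mul, Real.norm_eq_abs, Real.norm_eq_abs]
    calc |wrightM β y| * |f (τ ^ β * y)|
        ≤ (D₀ * Real.exp (-((a₀ * τ ^ β + 1) * y))) * (C₀ * Real.exp (a₀ * (τ ^ β * y))) := by
          gcongr
          · exact hM₀ y hy
          · exact hf₀ _ (by positivity)
      _ = D₀ * C₀ * (Real.exp (-((a₀ * τ ^ β + 1) * y)) * Real.exp (a₀ * (τ ^ β * y))) := by ring
      _ = _ := by
          rw [← Real.exp_add, sub_self, Real.rpow_zero, one_mul]
          congr 2
          ring
  · refine hMm.mul (Measurable.aestronglyMeasurable ?_)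
    have := measurable_deriv f
    fun_prop
  · refine (ae_restrict_iff' measurableSet_Ioi).2 (ae_of_all _ fun y (hy : 0 < y) σ hσ => ?_)
    have hσ0 : 0 < σ := by linarith [hσ.1]
    have h1 : σ ^ β ≤ T := Real.rpow_le_rpow hσ0.le hσ.2.le hβ0.le
    have h2 : σ ^ (β - 1) ≤ L :=
      Real.rpow_le_rpow_of_nonpos (by positivity) hσ.1.le (by linarith)
    rw [norm_mul, norm_mul, Real.norm_eq_abs, Real.norm_eq_abs,
      Real.norm_of_nonneg (by positivity)]
    calc |wrightM β y| * (|deriv f (σ ^ β * y)| * (β * σ ^ (β - 1) * y))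
        ≤ (D₁ * Real.exp (-((a₁ * T + 1) * y))) *
            ((C₁ * Real.exp (a₁ * (T * y))) * (β * L * y)) := by
          gcongr
          · exact hM₁ y hy
          · refine (hf₁ _ (by positivity)).trans ?_
            gcongr
      _ = D₁ * C₁ * (β * L) *
            (y * (Real.exp (-((a₁ * T + 1) * y)) * Real.exp (a₁ * (T * y)))) := by ring
      _ = _ := by
          rw [← Real.exp_add, show (2 : ℝ) - 1 = 1 by norm_num, Real.rpow_one]
          congr 3
          ring
  · exact (integrableOn_rpow_mul_exp_neg_mul_Ioi two_pos one_pos).const_mul _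
  · refine (ae_restrict_iff' measurableSet_Ioi).2 (ae_of_all _ fun y (hy : 0 < y) σ hσ => ?_)
    have hσ0 : 0 < σ := by linarith [hσ.1]
    have h1 : HasDerivAt (fun σ : ℝ => σ ^ β * y) (β * σ ^ (β - 1) * y) σ :=
      (Real.hasDerivAt_rpow_const (Or.inl hσ0.ne')).mul_const y
    exact ((hdiff _ (by positivity)).comp σ h1).const_mul _

lemma integrableOn_sub_rpow_mul_rpow {p q : ℝ} (hp : -1 < p) (hq : -1 < q) {t : ℝ} (ht : 0 < t) :
    IntegrableOn (fun τ : ℝ => (t - τ) ^ p * τ ^ q) (Ioc 0 t) := by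
  rw [← intervalIntegrable_iff_integrableOn_Ioc_of_le ht.le]
  have hhalf : ∀ {p q : ℝ}, -1 < q →
      IntervalIntegrable (fun τ : ℝ => (t - τ) ^ p * τ ^ q) volume 0 (t / 2) := by
    intro p q hq
    refine (intervalIntegral.intervalIntegrable_rpow' hq).continuousOn_mul ?_
    rw [uIcc_of_le (by positivity)]
    intro τ hτ
    have : t - τ ≠ 0 := by have := hτ.2; intro h; linarith
    exact ContinuousAt.continuousWithinAt
      ((Real.continuousAt_rpow_const _ _ (Or.inl this)).comp (by fun_prop))
  refine (hhalf hq).trans ?_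
  have h := ((hhalf (p := q) (q := p) hp).comp_sub_left t).symm
  rw [sub_zero, sub_half] at h
  simpa only [sub_sub_cancel, mul_comm] using h

lemma mul_exp_neg_two_mul_le {u : ℝ} (hu : 0 < u) :
    u * Real.exp (-(2 * u)) ≤ u ^ (-(1 / 2 : ℝ)) := by
  have h1 : u ≤ Real.exp u := by linarith [Real.add_one_le_exp u]
  have h2 : u ^ (3 / 2 : ℝ) ≤ Real.exp (2 * u) := by
    calc u ^ (3 / 2 : ℝ) ≤ Real.exp u ^ (3 / 2 : ℝ) := by gcongr
      _ = Real.exp (u * (3 / 2)) := by rw [← Real.exp_mul]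
      _ ≤ _ := Real.exp_le_exp.2 (by linarith)
  have h3 : u = u ^ (-(1 / 2 : ℝ)) * u ^ (3 / 2 : ℝ) := by
    rw [← Real.rpow_add hu]; norm_num
  calc u * Real.exp (-(2 * u)) = u ^ (-(1 / 2 : ℝ)) * u ^ (3 / 2 : ℝ) * Real.exp (-(2 * u)) := by
        rw [← h3]
    _ ≤ u ^ (-(1 / 2 : ℝ)) * Real.exp (2 * u) * Real.exp (-(2 * u)) := by gcongr
    _ = _ := by rw [mul_assoc, ← Real.exp_add]; simp

lemma integrable_sub_rpow_mul_wrightBromwich_mul {β : ℝ} (hβ0 : 0 < β) (hβ1 : β < 1) {g : ℝ → ℝ}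
    (hg : Measurable g) (hge : ExpOrder g) {t : ℝ} (ht : 0 < t) :
    Integrable (Function.uncurry fun τ x : ℝ =>
        (t - τ) ^ (-β) * ((wrightBromwich β 0 x τ 1).re / π) * g x)
      ((volume.restrict (Ioc 0 t)).prod (volume.restrict (Ioi 0))) := by
  obtain ⟨C, a, hC, ha, hga⟩ := hge
  obtain ⟨D, hD, hM⟩ := exists_abs_wrightM_le hβ0 hβ1 (a := (a + 1) * t ^ β + 2) (by positivity)
  have h1 := integrableOn_sub_rpow_mul_rpow (p := -β) (q := β / 2 - 1) (by linarith)
    (by linarith) ht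
  have h2 := integrableOn_rpow_mul_exp_neg_mul_Ioi (s := 1 / 2) (b := 1) (by norm_num) one_pos
  refine ((h1.mul_prod h2).const_mul (β * D * C)).mono' ?_ ?_
  · refine Measurable.aestronglyMeasurable ?_
    have := (measurable_wrightBromwich β 0 1).comp (measurable_snd.prodMk measurable_fst)
    simp only [Function.comp_def] at this
    simp only [Function.uncurry_def]
    fun_prop
  · rw [Measure.prod_restrict]
    refine (ae_restrict_iff' (measurableSet_Ioc.prod measurableSet_Ioi)).2
      (ae_of_all _ fun p hp => ?_)
    obtain ⟨τ, x⟩ := p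
    have hτ : 0 < τ := hp.1.1
    have hτt : τ ≤ t := hp.1.2
    have hx : 0 < x := hp.2
    have hs : 0 ≤ t - τ := by linarith
    simp only [Function.uncurry_apply_pair]
    rw [← mul_wrightG_eq_wrightBromwich hβ0 hβ1 hx hτ one_pos, wrightG_eq_wrightM, norm_mul,
      norm_mul, norm_mul, norm_mul, Real.norm_of_nonneg (by positivity),
      Real.norm_of_nonneg (by positivity), Real.norm_of_nonneg (by positivity),
      Real.norm_eq_abs, Real.norm_eq_abs]
    set u : ℝ := x / τ ^ β with hu
    have hu0 : 0 < u := by positivity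
    have hxu : x = u * τ ^ β := by rw [hu]; field_simp
    have hxt : x ≤ u * t ^ β := by rw [hxu]; gcongr
    have hexp : u * (Real.exp (-(((a + 1) * t ^ β + 2) * u)) * Real.exp (a * x)) ≤
        u ^ (-(1 / 2 : ℝ)) * Real.exp (-(1 * x)) := by
      calc u * (Real.exp (-(((a + 1) * t ^ β + 2) * u)) * Real.exp (a * x))
          ≤ u * (Real.exp (-(2 * u)) * Real.exp (-(1 * x))) := by
            rw [← Real.exp_add, ← Real.exp_add]
            refine mul_le_mul_of_nonneg_left (Real.exp_le_exp.2 ?_) hu0.le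
            nlinarith
        _ = (u * Real.exp (-(2 * u))) * Real.exp (-(1 * x)) := by ring
        _ ≤ _ := by
            gcongr
            exact mul_exp_neg_two_mul_le hu0
    calc (t - τ) ^ (-β) * (β * x / τ * (τ ^ (-β) * |wrightM β u|)) * |g x|
        ≤ (t - τ) ^ (-β) * (β * x / τ * (τ ^ (-β) *
            (D * Real.exp (-(((a + 1) * t ^ β + 2) * u))))) * (C * Real.exp (a * x)) := by
          gcongr
          · exact hM u hu0
          · exact hga x hx.le
      _ = β * D * C * ((t - τ) ^ (-β) * τ⁻¹ *
            (u * (Real.exp (-(((a + 1) * t ^ β + 2) * u)) * Real.exp (a * x)))) := by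
          rw [hu, Real.rpow_neg hτ.le]
          ring
      _ ≤ β * D * C * ((t - τ) ^ (-β) * τ⁻¹ * (u ^ (-(1 / 2 : ℝ)) * Real.exp (-(1 * x)))) := by
          gcongr
      _ = _ := by
          rw [hu, Real.div_rpow hx.le (by positivity), ← Real.rpow_mul hτ.le, div_eq_mul_inv,
            ← Real.rpow_neg hτ.le, Real.rpow_sub_one hτ.ne',
            show -(β * -(1 / 2)) = β / 2 by ring, show (1 / 2 - 1 : ℝ) = -(1 / 2) by norm_num]
          ring

/-- For `f ∈ C¹([0,∞))` with `f` and `f'` of exponential order, the Caputo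
derivative of the Wright-type transform satisfies
`D_c^β f_β(t) = ∫_0^∞ f′(x) g_β(x;t) dx` for every `t > 0`. -/
theorem caputo_wrightTransform (β : ℝ) (hβ0 : 0 < β) (hβ1 : β < 1)
    (f : ℝ → ℝ) (hf : ContDiffOn ℝ 1 f (Set.Ici 0))
    (hfe : ExpOrder f) (hfe' : ExpOrder (deriv f)) (t : ℝ) (ht : 0 < t) :
    caputo β (fun τ => ∫ x in Set.Ioi (0:ℝ), wrightG β x τ * f x) t
      = ∫ x in Set.Ioi (0:ℝ), deriv f x * wrightG β x t := by
  have hΓ : Real.Gamma (1 - β) ≠ 0 := (Real.Gamma_pos_of_pos (by linarith)).ne'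
  have h1 : ∫ τ in (0:ℝ)..t, (t - τ) ^ (-β) *
      deriv (fun τ => ∫ x in Set.Ioi (0:ℝ), wrightG β x τ * f x) τ =
      ∫ τ in Ioc 0 t, ∫ x in Ioi (0 : ℝ),
        (t - τ) ^ (-β) * ((wrightBromwich β 0 x τ 1).re / π) * deriv f x := by
    rw [intervalIntegral.integral_of_le ht.le]
    refine setIntegral_congr_fun measurableSet_Ioc fun τ hτ => ?_
    simp only [mul_assoc]
    rw [(hasDerivAt_integral_wrightG_mul hβ0 hβ1 hf hfe hfe' hτ.1).deriv, integral_const_mul]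
    congr 1
    refine setIntegral_congr_fun measurableSet_Ioi fun x hx => ?_
    simp only [← mul_wrightG_eq_wrightBromwich hβ0 hβ1 hx hτ.1 one_pos]
  rw [caputo, h1, integral_integral_swap
    (integrable_sub_rpow_mul_wrightBromwich_mul hβ0 hβ1 (measurable_deriv f) hfe' ht),
    ← integral_const_mul]
  refine setIntegral_congr_fun measurableSet_Ioi fun x hx => ?_
  rw [integral_mul_const, ← intervalIntegral.integral_of_le ht.le,
    integral_sub_rpow_mul_wrightBromwich hβ0 hβ1 hx ht]
  field_simp
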